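/- Let x be a finite rooted-forest poset with n elements, let S be a lower set of x with |S| = i, and let T'' be a lower set of the induced subposet x∖S with |T''| = m (so that S ∪ T'' is a lower set of x). Then ℓ(x∖(S∪T'')) · ℓ(S) / ℓ(x) = (i!·(n−i−m)!/n!) · (∏_{v∈S} h_x(v)/h_S(v)) · ∏_{v∈T''} h_x(v), where x∖(S∪T'') and S carry the induced orders. -/

import Mathlib

open scoped Classical

noncomputable section

/-- `linExt T` : the number of linear extensions of the sub-poset `T`, i.e. of
order-preserving bijections from `T` (with the induced order) to the chain
`{1 < 2 < … < |T|}`. -/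
def linExt {X : Type} [PartialOrder X] (T : Finset X) : ℕ :=
  Nat.card {φ : {x // x ∈ T} ≃ Fin T.card //
    ∀ a b : {x // x ∈ T}, (a : X) ≤ (b : X) → (φ a : ℕ) ≤ (φ b : ℕ)}

/-- Order-preserving bijections from `α` to `Fin k`. -/
abbrev LinExtEquiv (α : Type) [PartialOrder α] (k : ℕ) : Type :=
  {φ : α ≃ Fin k // ∀ a b : α, a ≤ b → (φ a : ℕ) ≤ (φ b : ℕ)}

/-- Extend a bijection off `r` by sending `r` to `0`. -/
def extendZero {α : Type} (r : α) {k : ℕ} (ψ : {x // x ≠ r} ≃ Fin k) : α ≃ Fin (k + 1) :=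
  ((Equiv.optionSubtypeNe r).symm.trans ψ.optionCongr).trans (finSuccEquiv k).symm

lemma extendZero_self {α : Type} (r : α) {k : ℕ} (ψ : {x // x ≠ r} ≃ Fin k) :
    extendZero r ψ r = 0 := by
  simp [extendZero]

lemma extendZero_of_ne {α : Type} {r : α} {k : ℕ} (ψ : {x // x ≠ r} ≃ Fin k) (x : {x // x ≠ r}) :
    extendZero r ψ x = (ψ x).succ := by
  simp [extendZero, Equiv.optionSubtypeNe_symm_of_ne x.2]

lemma exists_extendZero_eq {α : Type} {r : α} {k : ℕ} (φ : α ≃ Fin (k + 1)) (h : φ r = 0) :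
    ∃ ψ : {x // x ≠ r} ≃ Fin k, extendZero r ψ = φ := by
  have h_ne : ∀ a, a ≠ r ↔ φ a ≠ 0 := fun a => by rw [← h, Ne, Ne, φ.apply_eq_iff_eq]
  refine ⟨(φ.subtypeEquiv h_ne).trans
    (finSuccAboveEquiv (0 : Fin (k + 1))).symm, ?_⟩
  ext x
  by_cases hx : x = r
  · subst hx
    rw [extendZero_self, h]
  · rw [extendZero_of_ne _ ⟨x, hx⟩, ← Fin.succAbove_zero]
    have := congrArg Subtype.val ((finSuccAboveEquiv (0 : Fin (k + 1))).apply_symm_apply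
      ⟨φ x, (h_ne x).1 hx⟩)
    rw [finSuccAboveEquiv_apply] at this
    exact congrArg Fin.val this

/-- Linear extensions with prescribed minimal first element `r` are the linear extensions of the
complement of `r`. -/
lemma card_linExtEquiv_fiber {α : Type} [PartialOrder α] {r : α} (hr : IsMin r)
    (k : ℕ) : Nat.card {φ : LinExtEquiv α (k + 1) // φ.1.symm 0 = r} =
      Nat.card (LinExtEquiv {x // x ≠ r} k) := by
  symm
  refine Nat.card_eq_of_bijective (fun ψ => ⟨⟨extendZero r ψ.1, ?_⟩, ?_⟩) ⟨?_, ?_⟩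
  · intro a b hab
    by_cases ha : a = r
    · subst ha
      simp [extendZero_self]
    · have hb : b ≠ r := by
        rintro rfl
        exact ha (le_antisymm hab (hr hab))
      rw [extendZero_of_ne _ ⟨a, ha⟩, extendZero_of_ne _ ⟨b, hb⟩]
      simpa using ψ.2 ⟨a, ha⟩ ⟨b, hb⟩ hab
  · rw [Equiv.symm_apply_eq, extendZero_self]
  · intro ψ χ h
    apply Subtype.ext
    ext x
    have h' : extendZero r ψ.1 = extendZero r χ.1 := congrArg (fun φ => φ.1.1) h
    have := congrArg (fun φ : α ≃ Fin (k + 1) => φ x) h'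
    simp only [extendZero_of_ne, Fin.succ_inj] at this
    rw [this]
  · rintro ⟨⟨φ, hφ⟩, h⟩
    obtain ⟨ψ, rfl⟩ := exists_extendZero_eq φ ((Equiv.symm_apply_eq _).1 h).symm
    refine ⟨⟨ψ, fun a b hab => ?_⟩, rfl⟩
    simpa [extendZero_of_ne] using hφ a b hab

lemma isEmpty_linExtEquiv_fiber {α : Type} [PartialOrder α] {r : α} (hr : ¬ IsMin r) (k : ℕ) :
    IsEmpty {φ : LinExtEquiv α (k + 1) // φ.1.symm 0 = r} := by
  refine ⟨fun ⟨⟨φ, hφ⟩, h⟩ => hr fun b hb => ?_⟩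
  have h0 : φ r = 0 := ((Equiv.symm_apply_eq _).1 h).symm
  have := hφ b r hb
  rw [h0] at this
  have hb0 : φ b = φ r := by
    rw [h0]
    exact Fin.ext (Nat.le_zero.1 this)
  exact (φ.injective hb0).ge

/-- In a finite forest the principal upper sets of the minimal elements partition the poset. -/
lemma sum_card_ge_isMin {α : Type} [Fintype α] [PartialOrder α]
    (hforest : ∀ v a b : α, a ≤ v → b ≤ v → a ≤ b ∨ b ≤ a) :
    ∑ r with IsMin r, (Finset.univ.filter fun w : α => r ≤ w).card = Fintype.card α := by
  have := Finset.sum_card_bipartiteAbove_eq_sum_card_bipartiteBelow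
    (s := Finset.univ.filter fun r : α => IsMin r) (t := (Finset.univ : Finset α)) (· ≤ ·)
  unfold Finset.bipartiteAbove Finset.bipartiteBelow at this
  rw [this, ← Finset.card_univ, Finset.card_eq_sum_ones]
  refine Finset.sum_congr rfl fun w _ => Finset.card_eq_one.2 ?_
  obtain ⟨r, hrw, hr⟩ := Finite.exists_le_minimal (p := fun _ : α => True) (a := w) trivial
  rw [minimal_true] at hr
  refine ⟨r, Finset.ext fun a => ?_⟩
  simp only [Finset.mem_filter, Finset.mem_univ, true_and, Finset.mem_singleton]
  refine ⟨fun ⟨ha, haw⟩ => ?_, fun h => h ▸ ⟨hr, hrw⟩⟩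
  rcases hforest w a r haw hrw with h | h
  · exact hr.eq_of_le h
  · exact (ha.eq_of_le h).symm

/-- Removing a minimal element does not change the other hook lengths. -/
lemma prod_card_ge_erase_isMin {α : Type} [Fintype α] [PartialOrder α] {r : α} (hr : IsMin r) :
    ∏ v : α, (Finset.univ.filter fun w : α => v ≤ w).card =
      (Finset.univ.filter fun w : α => r ≤ w).card *
        ∏ v : {x // x ≠ r}, (Finset.univ.filter fun w : {x // x ≠ r} => v ≤ w).card := by
  rw [Fintype.prod_eq_mul_prod_subtype_ne _ r]
  congr 1
  refine Finset.prod_congr rfl fun v _ => ?_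
  rw [← Finset.card_map (Function.Embedding.subtype _)]
  congr 1
  ext w
  simp only [Finset.mem_filter, Finset.mem_univ, true_and, Finset.mem_map,
    Function.Embedding.subtype_apply, Subtype.exists]
  constructor
  · intro h
    exact ⟨w, fun e => v.2 (hr.eq_of_le (e ▸ h)), h, rfl⟩
  · rintro ⟨a, _, h, rfl⟩
    exact h

/-- The hook length formula for finite forests. -/
lemma card_linExtEquiv_mul_prod_hook (k : ℕ) : ∀ (α : Type) [Fintype α] [PartialOrder α],
    (∀ v a b : α, a ≤ v → b ≤ v → a ≤ b ∨ b ≤ a) → Fintype.card α = k →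
    Nat.card (LinExtEquiv α k) * ∏ v : α, (Finset.univ.filter fun w : α => v ≤ w).card =
      k.factorial := by
  induction k with
  | zero =>
    intro α _ _ _ hk
    have := Fintype.card_eq_zero_iff.1 hk
    have : Unique (LinExtEquiv α 0) :=
      { default := ⟨Equiv.equivOfIsEmpty _ _, fun a => isEmptyElim a⟩
        uniq := fun φ => Subtype.ext (Equiv.ext fun a => isEmptyElim a) }
    simp
  | succ k ih =>
    intro α _ _ hforest hk
    have hfact : (k + 1).factorial =
        ∑ r with IsMin r, (Finset.univ.filter fun w : α => r ≤ w).card * k.factorial := by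
      rw [← Finset.sum_mul, sum_card_ge_isMin hforest, hk, Nat.factorial_succ]
    rw [hfact, ← Nat.card_congr (Equiv.sigmaFiberEquiv fun φ : LinExtEquiv α (k + 1) => φ.1.symm 0),
      Nat.card_sigma, Finset.sum_mul, Finset.sum_filter]
    refine Finset.sum_congr rfl fun r _ => ?_
    split_ifs with hr
    · rw [card_linExtEquiv_fiber hr, prod_card_ge_erase_isMin hr, mul_left_comm,
        ih {x // x ≠ r} (fun v a b => hforest v a b)
          (by rw [Fintype.card_subtype_compl, Fintype.card_subtype_eq, hk]; rfl)]
    · have := isEmpty_linExtEquiv_fiber hr k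
      simp

/-- The hook length formula for a subset of a forest. -/
lemma linExt_mul_prod_hook {X : Type} [PartialOrder X]
    (hforest : ∀ v a b : X, a ≤ v → b ≤ v → a ≤ b ∨ b ≤ a) (T : Finset X) :
    linExt T * ∏ v ∈ T, (T.filter fun w => v ≤ w).card = T.card.factorial := by
  rw [← card_linExtEquiv_mul_prod_hook T.card {x // x ∈ T}
    (fun v a b => hforest v a b) (by simp)]
  refine congrArg₂ _ rfl ?_
  rw [← Finset.prod_coe_sort]
  refine Finset.prod_congr rfl fun v _ => ?_
  symm
  rw [← Finset.card_map (Function.Embedding.subtype _)]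
  congr 1
  ext w
  simp only [Finset.mem_filter, Finset.mem_univ, true_and, Finset.mem_map,
    Function.Embedding.subtype_apply, Subtype.exists]
  constructor
  · rintro ⟨a, ha, h, rfl⟩
    exact ⟨ha, h⟩
  · rintro ⟨hw, h⟩
    exact ⟨w, hw, h, rfl⟩

/-- **Hook-length formula for ratios of linear-extension counts on rooted forests.**
Let `X` be a rooted-forest poset with `n` elements, `S` a lower set of `X` with `|S| = i`,
and `T''` a lower set of the induced subposet `X ∖ S` with `|T''| = m`.  Then
`ℓ(X∖(S∪T'')) ⬝ ℓ(S) / ℓ(X) = (i!(n-i-m)!/n!) ⬝ (∏_{v∈S} h_X(v)/h_S(v)) ⬝ ∏_{v∈T''} h_X(v)`. -/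
theorem forest_linext_hook_ratio (X : Type) [Fintype X] [PartialOrder X]
    (hforest : ∀ v a b : X, a ≤ v → b ≤ v → a ≤ b ∨ b ≤ a)
    (S T'' : Finset X)
    (hSlow : ∀ ⦃a b : X⦄, a ≤ b → b ∈ S → a ∈ S)
    (hTsub : ∀ v ∈ T'', v ∉ S)
    (hTlow : ∀ ⦃a b : X⦄, a ∉ S → a ≤ b → b ∈ T'' → a ∈ T'') :
    (linExt (Finset.univ \ (S ∪ T'')) : ℝ) * (linExt S : ℝ) /
        (linExt (Finset.univ : Finset X) : ℝ)
      = (((S.card.factorial : ℝ) *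
            ((Fintype.card X - S.card - T''.card).factorial : ℝ)) /
          ((Fintype.card X).factorial : ℝ)) *
        (∏ v ∈ S,
          (((Finset.univ : Finset X).filter (fun w => v ≤ w)).card : ℝ) /
            ((S.filter (fun w => v ≤ w)).card : ℝ)) *
        ∏ v ∈ T'', (((Finset.univ : Finset X).filter (fun w => v ≤ w)).card : ℝ) := by
  have hook_ne : ∀ T : Finset X,
      (∏ v ∈ T, ((T.filter (fun w => v ≤ w)).card : ℝ)) ≠ 0 := fun T =>
    Finset.prod_ne_zero_iff.2 fun v hv => Nat.cast_ne_zero.2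
      (Finset.card_ne_zero_of_mem (Finset.mem_filter.2 ⟨hv, le_rfl⟩))
  have linExt_eq : ∀ T : Finset X, (linExt T : ℝ) =
      T.card.factorial / ∏ v ∈ T, ((T.filter (fun w => v ≤ w)).card : ℝ) := fun T => by
    rw [eq_div_iff (hook_ne T)]
    exact_mod_cast linExt_mul_prod_hook hforest T
  have hdisj : Disjoint S T'' := Finset.disjoint_right.2 hTsub
  have hcard : (Finset.univ \ (S ∪ T'')).card = Fintype.card X - S.card - T''.card := by
    rw [Finset.card_sdiff_of_subset (Finset.subset_univ _), Finset.card_union_of_disjoint hdisj,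
      Finset.card_univ, Nat.sub_sub]
  have hupper : ∏ v ∈ Finset.univ \ (S ∪ T''),
        (((Finset.univ \ (S ∪ T'')).filter (fun w => v ≤ w)).card : ℝ) =
      ∏ v ∈ Finset.univ \ (S ∪ T''),
        (((Finset.univ : Finset X).filter (fun w => v ≤ w)).card : ℝ) := by
    refine Finset.prod_congr rfl fun v hv => ?_
    congr 2
    ext w
    simp only [Finset.mem_sdiff, Finset.mem_univ, true_and, Finset.mem_union, not_or,
      Finset.mem_filter] at hv ⊢
    exact ⟨fun h => h.2, fun h => ⟨⟨fun hw => hv.1 (hSlow h hw),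
      fun hw => hv.2 (hTlow hv.1 h hw)⟩, h⟩⟩
  have hprod := Finset.prod_sdiff (Finset.subset_univ (S ∪ T''))
    (f := fun v => (((Finset.univ : Finset X).filter (fun w => v ≤ w)).card : ℝ))
  rw [Finset.prod_union hdisj] at hprod
  have hne := hook_ne Finset.univ
  rw [← hprod] at hne
  have hU := left_ne_zero_of_mul hne
  have hS := hook_ne S
  have hn : ((Fintype.card X).factorial : ℝ) ≠ 0 := Nat.cast_ne_zero.2 (Nat.factorial_ne_zero _)
  rw [linExt_eq, linExt_eq, linExt_eq, hupper, hcard, ← hprod, Finset.card_univ,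
    Finset.prod_div_distrib]
  clear * - hU hS hn
  generalize ((Fintype.card X).factorial : ℝ) = n at *
  generalize (∏ v ∈ S, ((S.filter (fun w => v ≤ w)).card : ℝ)) = s at *
  generalize (∏ v ∈ Finset.univ \ (S ∪ T''),
    (((Finset.univ : Finset X).filter (fun w => v ≤ w)).card : ℝ)) = u at *
  field_simp

end
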